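/- Let G be a finite group, let 𝒞 = (𝒳,𝒦) be a supercharacter theory of G, and let N be a 𝒞-normal subgroup of G. For Z ⊆ Irr(G), let f(Z) denote the set of irreducible constituents of the restricted character (σ_Z)_N. Then for every X, Y ∈ 𝒳, either f(X) ∩ f(Y) = ∅ or f(X) = f(Y). -/

import Mathlib

open scoped Classical

noncomputable section

/-- The set of irreducible complex characters of `G`. -/
def Irr (G : Type) [Group G] : Set (G → ℂ) :=
  {χ | ∃ V : FDRep ℂ G, CategoryTheory.Simple V ∧ FDRep.character V = χ}

/-- `σ_X = ∑_{ψ ∈ X} ψ(1)·ψ`. -/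
def sigmaChar {G : Type} [Group G] (X : Set (G → ℂ)) : G → ℂ :=
  fun g => ∑ᶠ ψ ∈ X, ψ 1 * ψ g

/-- `P` is a set partition of the set `S`. -/
def IsPartitionOf {α : Type*} (S : Set α) (P : Set (Set α)) : Prop :=
  ∅ ∉ P ∧ (∀ p ∈ P, p ⊆ S) ∧ ∀ a ∈ S, ∃! p, p ∈ P ∧ a ∈ p

/-- `(𝒳, 𝒦)` is a supercharacter theory of the finite group `G`. -/
def IsSCT (G : Type) [Group G] [Finite G]
    (𝒳 : Set (Set (G → ℂ))) (𝒦 : Set (Set G)) : Prop :=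
  IsPartitionOf (Irr G) 𝒳 ∧ IsPartitionOf Set.univ 𝒦 ∧ 𝒳.ncard = 𝒦.ncard ∧
    ({1} : Set G) ∈ 𝒦 ∧
    ∀ X ∈ 𝒳, ∀ K ∈ 𝒦, ∀ g ∈ K, ∀ h ∈ K, sigmaChar X g = sigmaChar X h

/-- `K̂ = ∑_{g ∈ K} g ∈ ℂ[G]`. -/
def ghat {G : Type} [Group G] (K : Set G) : MonoidAlgebra ℂ G :=
  ∑ᶠ g ∈ K, MonoidAlgebra.single g (1 : ℂ)

/-- The central idempotent `e_χ = (χ(1)/|G|) ∑_g conj(χ g)·g` attached to a character. -/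
def eIdem (G : Type) [Group G] (χ : G → ℂ) : MonoidAlgebra ℂ G :=
  (χ 1 / (Nat.card G : ℂ)) •
    ∑ᶠ g : G, (starRingEnd ℂ) (χ g) • MonoidAlgebra.single g (1 : ℂ)

/-- `f_X = ∑_{ψ ∈ X} e_ψ`. -/
def fIdem (G : Type) [Group G] (X : Set (G → ℂ)) : MonoidAlgebra ℂ G :=
  ∑ᶠ χ ∈ X, eIdem G χ

/-- Partition order: every part of `P` lies in some part of `Q`. -/
def PartLE {α : Type*} (P Q : Set (Set α)) : Prop := ∀ p ∈ P, ∃ q ∈ Q, p ⊆ q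

/-- The join of two partitions of the same set: parts are connected components of
the relation "lying in a common part of `P` or of `Q`". -/
def PartJoin {α : Type*} (P Q : Set (Set α)) : Set (Set α) :=
  {C | ∃ a ∈ ⋃₀ P, C = {b | Relation.ReflTransGen
      (fun x y => (∃ p ∈ P, x ∈ p ∧ y ∈ p) ∨ ∃ q ∈ Q, x ∈ q ∧ y ∈ q) a b}}

/-- Inner product of complex-valued functions on a finite group. -/
def cInner (H : Type) [Group H] (α β : H → ℂ) : ℂ :=
  (Nat.card H : ℂ)⁻¹ * ∑ᶠ h : H, α h * (starRingEnd ℂ) (β h)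

/-- Restriction of a function on `G` to a subgroup. -/
def resChar {G : Type} [Group G] (H : Subgroup G) (χ : G → ℂ) : ↥H → ℂ := fun h => χ ↑h

/-- Extension by zero of a function on a subgroup. -/
def zeroExtend {G : Type} [Group G] (H : Subgroup G) (φ : ↥H → ℂ) : G → ℂ :=
  fun g => if h : g ∈ H then φ ⟨g, h⟩ else 0

/-- The induced class function `φ^G`. -/
def indChar {G : Type} [Group G] (H : Subgroup G) (φ : ↥H → ℂ) : G → ℂ :=
  fun g => (Nat.card ↥H : ℂ)⁻¹ * ∑ᶠ x : G, zeroExtend H φ (x⁻¹ * g * x)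

/-- The superclass of `x` with respect to a partition `𝒦` of `G`. -/
def sclass {G : Type} [Group G] (𝒦 : Set (Set G)) (x : G) : Set G := ⋃₀ {K ∈ 𝒦 | x ∈ K}

/-- Superinduction: `φ^{(G)}(x) = [G:H]·(1/|[x]|)·∑_{y ∈ [x]} φ⁰(y)`. -/
def superInd {G : Type} [Group G] (𝒦 : Set (Set G)) (H : Subgroup G) (φ : ↥H → ℂ) : G → ℂ :=
  fun x => (H.index : ℂ) * (((sclass 𝒦 x).ncard : ℂ))⁻¹ * ∑ᶠ y ∈ sclass 𝒦 x, zeroExtend H φ y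

/-- A subgroup is `𝒞`-normal when it is a union of superclasses. -/
def CNormal {G : Type} [Group G] (𝒦 : Set (Set G)) (N : Subgroup G) : Prop :=
  ∃ T ⊆ 𝒦, (N : Set G) = ⋃₀ T

/-- `Irr(G/N)` viewed inside `Irr(G)`: irreducible characters with `N` in their kernel. -/
def IrrOver {G : Type} [Group G] (N : Subgroup G) : Set (G → ℂ) :=
  {χ ∈ Irr G | ∀ n ∈ N, χ n = χ 1}

/-- The set of irreducible constituents of the restriction of `θ` to `N`. -/
def constituentsOn {G : Type} [Group G] (N : Subgroup G) (θ : G → ℂ) : Set (↥N → ℂ) :=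
  {ψ ∈ Irr ↥N | cInner ↥N (resChar N θ) ψ ≠ 0}

/-- `Irr(G|ψ)`: irreducible characters of `G` lying over `ψ ∈ Irr(N)`. -/
def irrOverChar {G : Type} [Group G] (N : Subgroup G) (ψ : ↥N → ℂ) : Set (G → ℂ) :=
  {χ ∈ Irr G | cInner ↥N (resChar N χ) ψ ≠ 0}

/-- `X^G = ⋃_{ψ ∈ X} Irr(G|ψ)` for `X ⊆ Irr(N)`. -/
def indSet {G : Type} [Group G] (N : Subgroup G) (X : Set (↥N → ℂ)) : Set (G → ℂ) :=
  ⋃ ψ ∈ X, irrOverChar N ψ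

/-- Conjugation of a normal subgroup by a group element. -/
def conjSub {G : Type} [Group G] {N : Subgroup G} (hN : N.Normal) (g : G) (n : ↥N) : ↥N :=
  ⟨g * ↑n * g⁻¹, hN.conj_mem ↑n n.2 g⟩

/-- The conjugation action of `g ∈ G` on class functions of a normal subgroup `N`. -/
def charConj {G : Type} [Group G] {N : Subgroup G} (hN : N.Normal) (g : G)
    (ψ : ↥N → ℂ) : ↥N → ℂ :=
  fun n => ψ (conjSub hN g⁻¹ n)

/-- Inflation of a set of characters of `G/N` to characters of `G`. -/
def inflateSet {G : Type} [Group G] (N : Subgroup G) [N.Normal]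
    (Y : Set (G ⧸ N → ℂ)) : Set (G → ℂ) :=
  (fun η => η ∘ (QuotientGroup.mk : G → G ⧸ N)) '' Y

/-- Deflation of a set of characters of `G` (with `N` in their kernels) to characters
of `G/N`. -/
def deflate {G : Type} [Group G] (N : Subgroup G) [N.Normal]
    (X : Set (G → ℂ)) : Set (G ⧸ N → ℂ) :=
  (fun χ => fun q : G ⧸ N => χ (Quotient.out q)) '' X

/-- The natural map `M → MN/N ≤ G/N`. -/
def projMN {G : Type} [Group G] (M N : Subgroup G) [N.Normal] (m : ↥M) :
    ↥(M.map (QuotientGroup.mk' N)) :=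
  ⟨QuotientGroup.mk' N ↑m, Subgroup.mem_map_of_mem _ m.2⟩

end

section Convolution

variable {G : Type} [Group G] [Fintype G]

/-- Convolution of complex-valued functions on a finite group, as a bilinear map. -/
noncomputable def convolution : (G → ℂ) →ₗ[ℂ] (G → ℂ) →ₗ[ℂ] (G → ℂ) :=
  LinearMap.mk₂ ℂ (fun a b g => ∑ x, a x * b (x⁻¹ * g))
    (fun a₁ a₂ b => by ext g; simp [add_mul, Finset.sum_add_distrib])
    (fun c a b => by ext g; simp [mul_assoc, Finset.mul_sum])
    (fun a b₁ b₂ => by ext g; simp [mul_add, Finset.sum_add_distrib])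
    (fun c a b => by ext g; simp [mul_left_comm, Finset.mul_sum])

theorem convolution_apply (a b : G → ℂ) (g : G) :
    convolution a b g = ∑ x, a x * b (x⁻¹ * g) := rfl

theorem convolution_assoc (a b c : G → ℂ) :
    convolution (convolution a b) c = convolution a (convolution b c) := by
  ext g
  simp only [convolution_apply, Finset.sum_mul, Finset.mul_sum]
  rw [Finset.sum_comm]
  refine Finset.sum_congr rfl fun x _ => ?_
  refine Fintype.sum_equiv (Equiv.mulLeft x⁻¹) _ _ fun y => ?_
  simp [mul_assoc]

theorem resChar_convolution_indicator (N : Subgroup G) [Fintype N] (a b : G → ℂ) :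
    resChar N (convolution (Set.indicator (N : Set G) a) b) =
      convolution (resChar N a) (resChar N b) := by
  ext n
  simp only [resChar, convolution_apply, Subgroup.coe_mul, Subgroup.coe_inv]
  rw [← Finset.sum_subset (Finset.subset_univ (N : Set G).toFinset) fun x _ hx => by
    rw [Set.indicator_of_notMem (by simpa using hx), zero_mul]]
  rw [Finset.sum_subtype (N : Set G).toFinset (p := (· ∈ N))
    (F := inferInstance) fun x => by simp]
  exact Finset.sum_congr rfl fun x _ => by rw [Set.indicator_of_mem x.2]

end Convolution

section Character

variable {G : Type} [Group G]

theorem exists_eq_smul_id_of_commute (V : FDRep ℂ G) [CategoryTheory.Simple V]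
    (T : V →ₗ[ℂ] V) (hT : ∀ g, T ∘ₗ V.ρ g = V.ρ g ∘ₗ T) : ∃ c : ℂ, T = c • LinearMap.id := by
  let φ : V ⟶ V := ⟨CategoryTheory.InducedCategory.homMk (ModuleCat.ofHom T), fun g => by
    ext1
    exact hT g⟩
  obtain ⟨c, hc⟩ := CategoryTheory.endomorphism_simple_eq_smul_id ℂ φ
  refine ⟨c, ?_⟩
  have := congrArg (fun ψ : V ⟶ V => ψ.hom.hom.hom) hc
  exact this.symm

theorem apply_mul_comm_of_mem_Irr {χ : G → ℂ} (hχ : χ ∈ Irr G) (x y : G) :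
    χ (x * y) = χ (y * x) := by
  obtain ⟨V, -, rfl⟩ := hχ
  exact V.char_mul_comm y x

theorem sigmaChar_eq_sum {X : Set (G → ℂ)} (hX : X.Finite) :
    sigmaChar X = ∑ χ ∈ hX.toFinset, χ 1 • χ := by
  ext g
  simp [sigmaChar, finsum_mem_eq_finite_toFinset_sum _ hX]

theorem sigmaChar_apply_mul_comm {X : Set (G → ℂ)} (hX : X ⊆ Irr G) (x y : G) :
    sigmaChar X (x * y) = sigmaChar X (y * x) :=
  finsum_mem_congr rfl fun χ hχ => by rw [apply_mul_comm_of_mem_Irr (hX hχ)]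

theorem linearIndependent_of_dual {ι M : Type*} [AddCommGroup M] [Module ℂ M] (v : ι → M)
    (L : ι → M →ₗ[ℂ] ℂ) (hne : ∀ i j, i ≠ j → L i (v j) = 0) (hself : ∀ i, L i (v i) ≠ 0) :
    LinearIndependent ℂ v := by
  refine linearIndependent_iff'.2 fun s c hs i hi => ?_
  have h := congrArg (L i) hs
  rw [map_sum, map_zero, Finset.sum_eq_single_of_mem i hi fun j _ hj => by
    rw [map_smul, hne i j hj.symm, smul_zero], map_smul, smul_eq_mul] at h
  exact (mul_eq_zero.1 h).resolve_right (hself i)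

variable [Fintype G]

open scoped ComplexOrder in
theorem FDRep.character_conj_eq_inv (V : FDRep ℂ G) (g : G) :
    (starRingEnd ℂ) (V.character g) = V.character g⁻¹ := by
  let B := Module.finBasis ℂ V
  let A : G → Matrix (Fin (Module.finrank ℂ V)) (Fin (Module.finrank ℂ V)) ℂ :=
    fun x => LinearMap.toMatrix B B (V.ρ x)
  have hmul : ∀ x y, A (x * y) = A x * A y := fun x y => by
    simp only [A, map_mul, LinearMap.toMatrix_mul]
  have hone : A 1 = 1 := by simp only [A, map_one, LinearMap.toMatrix_one]
  have htr : ∀ x, V.character x = (A x).trace := fun x =>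
    LinearMap.trace_eq_matrix_trace ℂ B (V.ρ x)
  let P := ∑ x, (A x).conjTranspose * A x
  have hP : P.PosDef := by
    have : P = 1 + ∑ x ∈ Finset.univ.erase (1 : G), (A x).conjTranspose * A x := by
      simp only [P]
      rw [← Finset.add_sum_erase Finset.univ _ (Finset.mem_univ (1 : G))]
      simp [hone]
    rw [this]
    exact Matrix.PosDef.one.add_posSemidef
      (Matrix.posSemidef_sum _ fun x _ => Matrix.posSemidef_conjTranspose_mul_self _)
  have hinv : (A g).conjTranspose * P * A g = P := by
    simp only [P, Finset.mul_sum, Finset.sum_mul]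
    refine Fintype.sum_equiv (Equiv.mulRight g) _ _ fun x => ?_
    simp [hmul, Matrix.conjTranspose_mul, Matrix.mul_assoc]
  have hinv' : (A g).conjTranspose * P = P * A g⁻¹ := by
    rw [← hinv, Matrix.mul_assoc _ (A g), ← hmul]
    simp [hone, hinv]
  have hu : IsUnit P.det := (Matrix.isUnit_iff_isUnit_det _).1 hP.isUnit
  have hA : (A g).conjTranspose = P * A g⁻¹ * P⁻¹ := by
    rw [← hinv', Matrix.mul_nonsing_inv_cancel_right _ _ hu]
  rw [htr, htr, starRingEnd_apply, ← Matrix.trace_conjTranspose, hA, Matrix.trace_mul_comm,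
    Matrix.nonsing_inv_mul_cancel_left _ _ hu]

theorem exists_convolution_eq_smul {a : G → ℂ} (ha : ∀ x y, a (x * y) = a (y * x))
    {χ : G → ℂ} (hχ : χ ∈ Irr G) : ∃ c : ℂ, convolution a χ = c • χ := by
  obtain ⟨V, hV, rfl⟩ := hχ
  obtain ⟨c, hc⟩ := exists_eq_smul_id_of_commute V (∑ x, a x • V.ρ x⁻¹) fun g => by
    simp only [← Module.End.mul_eq_comp, Finset.mul_sum, Finset.sum_mul, smul_mul_assoc,
      mul_smul_comm, ← map_mul]
    refine Fintype.sum_equiv (MulAut.conj g⁻¹).toEquiv _ _ fun x => ?_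
    simp [mul_assoc, ha g⁻¹]
  refine ⟨c, funext fun h => ?_⟩
  have := congrArg (fun T => LinearMap.trace ℂ V (T * V.ρ h)) hc
  simpa [Finset.sum_mul, ← map_mul, convolution_apply, FDRep.character, ← Module.End.one_eq_id]
    using this

theorem convolution_one_of_mem_Irr {χ ψ : G → ℂ} (hχ : χ ∈ Irr G) (hψ : ψ ∈ Irr G) :
    convolution χ ψ 1 = if χ = ψ then (Nat.card G : ℂ) else 0 := by
  obtain ⟨V, hV, rfl⟩ := hχ
  obtain ⟨W, hW, rfl⟩ := hψ
  have hG : (Nat.card G : ℂ) ≠ 0 := Nat.cast_ne_zero.2 Nat.card_pos.ne'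
  have := invertibleOfNonzero hG
  have key : V.character = W.character ↔ Nonempty (V ≅ W) := by
    refine ⟨fun h => ?_, fun ⟨i⟩ => FDRep.char_iso i⟩
    by_contra hn
    have h₁ := FDRep.char_orthonormal V W
    have h₂ := FDRep.char_orthonormal W W
    rw [h, h₂, if_neg hn, if_pos ⟨CategoryTheory.Iso.refl W⟩] at h₁
    exact one_ne_zero h₁
  have h := FDRep.char_orthonormal V W
  rw [inv_mul_eq_iff_eq_mul₀ hG] at h
  simp only [convolution_apply, mul_one, h, key, mul_ite, mul_zero]

theorem apply_one_ne_zero_of_mem_Irr {χ : G → ℂ} (hχ : χ ∈ Irr G) : χ 1 ≠ 0 := by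
  intro h
  obtain ⟨c, hc⟩ := exists_convolution_eq_smul (apply_mul_comm_of_mem_Irr hχ) hχ
  have h₁ := convolution_one_of_mem_Irr hχ hχ
  rw [hc, if_pos rfl, Pi.smul_apply, h, smul_zero] at h₁
  exact Nat.cast_ne_zero.2 Nat.card_pos.ne' h₁.symm

theorem smul_convolution_of_mem_Irr {χ ψ : G → ℂ} (hχ : χ ∈ Irr G) (hψ : ψ ∈ Irr G) :
    χ 1 • convolution χ ψ = if χ = ψ then (Nat.card G : ℂ) • ψ else 0 := by
  obtain ⟨c, hc⟩ := exists_convolution_eq_smul (apply_mul_comm_of_mem_Irr hχ) hψ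
  have h₁ := convolution_one_of_mem_Irr hχ hψ
  rw [hc, Pi.smul_apply, smul_eq_mul] at h₁
  rw [hc]
  split_ifs at h₁ ⊢ with h
  · rw [smul_smul, h, mul_comm, h₁]
  · rw [(mul_eq_zero.1 h₁).resolve_right (apply_one_ne_zero_of_mem_Irr hψ), zero_smul, smul_zero]

theorem cInner_eq_convolution_one (a : G → ℂ) {χ : G → ℂ} (hχ : χ ∈ Irr G) :
    cInner G a χ = (Nat.card G : ℂ)⁻¹ * convolution a χ 1 := by
  obtain ⟨V, -, rfl⟩ := hχ
  simp [cInner, convolution_apply, finsum_eq_sum_of_fintype, FDRep.character_conj_eq_inv]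

theorem cInner_ne_zero_iff {a χ : G → ℂ} (hχ : χ ∈ Irr G) {c : ℂ}
    (hc : convolution a χ = c • χ) : cInner G a χ ≠ 0 ↔ c ≠ 0 := by
  simp [cInner_eq_convolution_one a hχ, hc, apply_one_ne_zero_of_mem_Irr hχ]

/-- The linear functional `a ↦ (a * χ)(1)`. -/
noncomputable def convolutionAtOne (χ : G → ℂ) : (G → ℂ) →ₗ[ℂ] ℂ :=
  LinearMap.proj 1 ∘ₗ convolution.flip χ

theorem convolutionAtOne_apply (a χ : G → ℂ) : convolutionAtOne χ a = convolution a χ 1 := rfl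

variable (G) in
theorem finite_Irr : (Irr G).Finite := by
  have hli : LinearIndependent ℂ ((↑) : Irr G → G → ℂ) := by
    refine linearIndependent_of_dual _ (fun χ => convolutionAtOne χ) (fun χ ψ h => ?_) fun χ => ?_
    · rw [convolutionAtOne_apply, convolution_one_of_mem_Irr ψ.2 χ.2, if_neg]
      exact fun e => h (Subtype.ext e.symm)
    · rw [convolutionAtOne_apply, convolution_one_of_mem_Irr χ.2 χ.2, if_pos rfl]
      exact Nat.cast_ne_zero.2 Nat.card_pos.ne'
  exact hli.setFinite

theorem convolution_sigmaChar_of_mem_Irr {X : Set (G → ℂ)} (hX : X ⊆ Irr G) {χ : G → ℂ}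
    (hχ : χ ∈ Irr G) :
    convolution (sigmaChar X) χ = if χ ∈ X then (Nat.card G : ℂ) • χ else 0 := by
  have hf := (finite_Irr G).subset hX
  rw [sigmaChar_eq_sum hf, map_sum, LinearMap.sum_apply]
  simp only [map_smul, LinearMap.smul_apply]
  rw [Finset.sum_congr rfl fun ψ hψ =>
    smul_convolution_of_mem_Irr (hX (hf.mem_toFinset.1 hψ)) hχ]
  simp

theorem convolution_sigmaChar_of_forall {X : Set (G → ℂ)} (hX : X ⊆ Irr G) {a : G → ℂ} {c : ℂ}
    (h : ∀ χ ∈ X, convolution a χ = c • χ) :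
    convolution a (sigmaChar X) = c • sigmaChar X := by
  have hf := (finite_Irr G).subset hX
  rw [sigmaChar_eq_sum hf, map_sum, Finset.smul_sum]
  refine Finset.sum_congr rfl fun χ hχ => ?_
  rw [map_smul, h χ (hf.mem_toFinset.1 hχ), smul_comm]

end Character

section Supercharacter

theorem IsPartitionOf.eq_of_mem {α : Type*} {S : Set α} {P : Set (Set α)}
    (h : IsPartitionOf S P) {p q : Set α} (hp : p ∈ P) (hq : q ∈ P) {a : α} (hap : a ∈ p)
    (haq : a ∈ q) : p = q :=
  (h.2.2 a (h.2.1 p hp hap)).unique ⟨hp, hap⟩ ⟨hq, haq⟩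

theorem IsPartitionOf.nonempty_of_mem {α : Type*} {S : Set α} {P : Set (Set α)}
    (h : IsPartitionOf S P) {p : Set α} (hp : p ∈ P) : p.Nonempty :=
  Set.nonempty_iff_ne_empty.2 fun he => h.1 (he ▸ hp)

/-- The space of functions on `α` that are constant on every member of `𝒦`. -/
def superclassFunctions {α : Type*} (𝒦 : Set (Set α)) : Submodule ℂ (α → ℂ) where
  carrier := {a | ∀ K ∈ 𝒦, ∀ g ∈ K, ∀ h ∈ K, a g = a h}
  add_mem' ha hb K hK g hg h hh := congrArg₂ (· + ·) (ha K hK g hg h hh) (hb K hK g hg h hh)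
  zero_mem' _ _ _ _ _ _ := rfl
  smul_mem' c _ ha K hK g hg h hh := congrArg (c * ·) (ha K hK g hg h hh)

theorem finrank_superclassFunctions_le {α : Type*} [Finite α] {𝒦 : Set (Set α)}
    (h𝒦 : IsPartitionOf Set.univ 𝒦) :
    Module.finrank ℂ (superclassFunctions 𝒦) ≤ 𝒦.ncard := by
  have := Fintype.ofFinite α
  choose r hr using fun K : 𝒦 => h𝒦.nonempty_of_mem K.2
  let E : superclassFunctions 𝒦 →ₗ[ℂ] (𝒦 → ℂ) :=
    LinearMap.funLeft ℂ ℂ r ∘ₗ (superclassFunctions 𝒦).subtype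
  have hE : Function.Injective E := by
    intro a b hab
    ext g
    obtain ⟨K, ⟨hK, hg⟩, -⟩ := h𝒦.2.2 g (Set.mem_univ g)
    rw [a.2 K hK g hg _ (hr ⟨K, hK⟩), b.2 K hK g hg _ (hr ⟨K, hK⟩)]
    exact congrFun hab ⟨K, hK⟩
  refine (LinearMap.finrank_le_finrank_of_injective hE).trans ?_
  rw [Module.finrank_fintype_fun_eq_card, Fintype.card_eq_nat_card, Nat.card_coe_set_eq]

variable {G : Type} [Group G]

theorem indicator_mem_superclassFunctions {𝒦 : Set (Set G)} (h𝒦 : IsPartitionOf Set.univ 𝒦)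
    {N : Subgroup G} (hN : CNormal 𝒦 N) {a : G → ℂ} (ha : a ∈ superclassFunctions 𝒦) :
    Set.indicator (N : Set G) a ∈ superclassFunctions 𝒦 := by
  obtain ⟨T, hT, hNT⟩ := hN
  have hmem : ∀ K ∈ 𝒦, ∀ g ∈ K, ∀ h ∈ K, g ∈ (N : Set G) → h ∈ (N : Set G) := by
    intro K hK g hg h hh hgN
    rw [hNT] at hgN ⊢
    obtain ⟨L, hL, hgL⟩ := hgN
    exact ⟨L, hL, h𝒦.eq_of_mem hK (hT hL) hg hgL ▸ hh⟩
  intro K hK g hg h hh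
  by_cases hgN : g ∈ (N : Set G)
  · rw [Set.indicator_of_mem hgN, Set.indicator_of_mem (hmem K hK g hg h hh hgN),
      ha K hK g hg h hh]
  · rw [Set.indicator_of_notMem hgN,
      Set.indicator_of_notMem fun hhN => hgN (hmem K hK h hh g hg hhN)]

variable [Fintype G]

theorem linearIndependent_sigmaChar {𝒳 : Set (Set (G → ℂ))} (h𝒳 : IsPartitionOf (Irr G) 𝒳) :
    LinearIndependent ℂ fun X : 𝒳 => sigmaChar X.1 := by
  choose r hr using fun X : 𝒳 => h𝒳.nonempty_of_mem X.2
  have hirr : ∀ X : 𝒳, r X ∈ Irr G := fun X => h𝒳.2.1 X X.2 (hr X)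
  refine linearIndependent_of_dual _ (fun X => convolutionAtOne (r X)) (fun X Y h => ?_) fun X => ?_
  · rw [convolutionAtOne_apply, convolution_sigmaChar_of_mem_Irr (h𝒳.2.1 Y Y.2) (hirr X),
      if_neg fun hX => h (Subtype.ext (h𝒳.eq_of_mem X.2 Y.2 (hr X) hX)), Pi.zero_apply]
  · rw [convolutionAtOne_apply, convolution_sigmaChar_of_mem_Irr (h𝒳.2.1 X X.2) (hirr X),
      if_pos (hr X)]
    exact mul_ne_zero (Nat.cast_ne_zero.2 Nat.card_pos.ne') (apply_one_ne_zero_of_mem_Irr (hirr X))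

theorem span_sigmaChar_eq_superclassFunctions {𝒳 : Set (Set (G → ℂ))} {𝒦 : Set (Set G)}
    (h : IsSCT G 𝒳 𝒦) :
    Submodule.span ℂ (Set.range fun X : 𝒳 => sigmaChar X.1) = superclassFunctions 𝒦 := by
  obtain ⟨h𝒳, h𝒦, hcard, -, hσ⟩ := h
  have hfin : Finite 𝒳 := Set.Finite.to_subtype <|
    (finite_Irr G).finite_subsets.subset fun X hX => h𝒳.2.1 X hX
  have := Fintype.ofFinite 𝒳
  refine Submodule.eq_of_le_of_finrank_le (Submodule.span_le.2 ?_) ?_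
  · rintro _ ⟨X, rfl⟩
    exact hσ X X.2
  · rw [finrank_span_eq_card (linearIndependent_sigmaChar h𝒳), Fintype.card_eq_nat_card,
      Nat.card_coe_set_eq, hcard]
    exact finrank_superclassFunctions_le h𝒦

theorem exists_convolution_sigmaChar_eq_smul {𝒳 : Set (Set (G → ℂ))} {𝒦 : Set (Set G)}
    (h : IsSCT G 𝒳 𝒦) {a : G → ℂ} (ha : a ∈ superclassFunctions 𝒦) {Y : Set (G → ℂ)}
    (hY : Y ∈ 𝒳) : ∃ c : ℂ, convolution a (sigmaChar Y) = c • sigmaChar Y := by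
  have h𝒳 := h.1
  rw [← span_sigmaChar_eq_superclassFunctions h] at ha
  induction ha using Submodule.span_induction with
  | mem a ha =>
    obtain ⟨X, rfl⟩ := ha
    refine ⟨if X.1 = Y then (Nat.card G : ℂ) else 0,
      convolution_sigmaChar_of_forall (h𝒳.2.1 Y hY) fun χ hχ => ?_⟩
    rw [convolution_sigmaChar_of_mem_Irr (h𝒳.2.1 X X.2) (h𝒳.2.1 Y hY hχ), ite_smul, zero_smul]
    exact if_congr ⟨fun hX => h𝒳.eq_of_mem X.2 hY hX hχ, fun e => e ▸ hχ⟩ rfl rfl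
  | zero => exact ⟨0, by simp⟩
  | add a b _ _ ha hb =>
    obtain ⟨c, hc⟩ := ha
    obtain ⟨d, hd⟩ := hb
    exact ⟨c + d, by rw [map_add, LinearMap.add_apply, hc, hd, add_smul]⟩
  | smul k a _ ha =>
    obtain ⟨c, hc⟩ := ha
    exact ⟨k * c, by rw [map_smul, LinearMap.smul_apply, hc, smul_smul]⟩

/-- If `(σ_X)_N` and `(σ_Y)_N` share a constituent, then every constituent of the former is a
constituent of the latter: both act on `Irr N` by scalars under convolution, and
`(σ_Y)_N * (σ_X)_N` is a scalar multiple of `(σ_X)_N`. -/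
theorem constituentsOn_subset_of_inter_nonempty {𝒳 : Set (Set (G → ℂ))} {𝒦 : Set (Set G)}
    (h : IsSCT G 𝒳 𝒦) {N : Subgroup G} (hN : CNormal 𝒦 N) {X Y : Set (G → ℂ)} (hX : X ∈ 𝒳)
    (hY : Y ∈ 𝒳)
    (hne : (constituentsOn N (sigmaChar X) ∩ constituentsOn N (sigmaChar Y)).Nonempty) :
    constituentsOn N (sigmaChar X) ⊆ constituentsOn N (sigmaChar Y) := by
  have hclass : ∀ Z ∈ 𝒳, ∀ x y : N,
      resChar N (sigmaChar Z) (x * y) = resChar N (sigmaChar Z) (y * x) := fun Z hZ x y =>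
    sigmaChar_apply_mul_comm (h.1.2.1 Z hZ) (x : G) y
  obtain ⟨c, hc⟩ := exists_convolution_sigmaChar_eq_smul h
    (indicator_mem_superclassFunctions h.2.1 hN (h.2.2.2.2 Y hY)) hX
  have hcN : convolution (resChar N (sigmaChar Y)) (resChar N (sigmaChar X)) =
      c • resChar N (sigmaChar X) := by
    rw [← resChar_convolution_indicator, hc]
    rfl
  have key : ∀ θ ∈ constituentsOn N (sigmaChar X),
      convolution (resChar N (sigmaChar Y)) θ = c • θ := by
    rintro θ ⟨hθ, hXθ⟩
    obtain ⟨α, hα⟩ := exists_convolution_eq_smul (hclass X hX) hθ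
    have hα0 := (cInner_ne_zero_iff hθ hα).1 hXθ
    have := convolution_assoc (resChar N (sigmaChar Y)) (resChar N (sigmaChar X)) θ
    rw [hcN, map_smul, LinearMap.smul_apply, hα, map_smul, smul_comm] at this
    exact (smul_right_injective _ hα0 this).symm
  obtain ⟨ψ, hψX, hψY⟩ := hne
  have hc0 : c ≠ 0 := (cInner_ne_zero_iff hψX.1 (key ψ hψX)).1 hψY.2
  exact fun θ hθ => ⟨hθ.1, (cInner_ne_zero_iff hθ.1 (key θ hθ)).2 hc0⟩

end Supercharacter

/-- Lemma 6.2. If `N` is `𝒞`-normal, then for `X, Y ∈ 𝒳` the sets of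
irreducible constituents of `(σ_X)_N` and `(σ_Y)_N` are disjoint or equal. -/
theorem stmt13 (G : Type) [Group G] [Finite G]
    (𝒳 : Set (Set (G → ℂ))) (𝒦 : Set (Set G)) (hSCT : IsSCT G 𝒳 𝒦)
    (N : Subgroup G) (hN : CNormal 𝒦 N) :
    ∀ X ∈ 𝒳, ∀ Y ∈ 𝒳,
      constituentsOn N (sigmaChar X) ∩ constituentsOn N (sigmaChar Y) = ∅ ∨
      constituentsOn N (sigmaChar X) = constituentsOn N (sigmaChar Y) := by
  intro X hX Y hY
  have := Fintype.ofFinite G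
  rcases Set.eq_empty_or_nonempty
    (constituentsOn N (sigmaChar X) ∩ constituentsOn N (sigmaChar Y)) with h | h
  · exact Or.inl h
  · exact Or.inr ((constituentsOn_subset_of_inter_nonempty hSCT hN hX hY h).antisymm
      (constituentsOn_subset_of_inter_nonempty hSCT hN hY hX (Set.inter_comm _ _ ▸ h)))
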